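/- (Lemma S2.1, item 3) Suppose the random vectors P_1 and P_2 are independent, P_2 is PRDS on {j : h_{2j} = 0}, and S is a valid selection rule. Let q_1' > 0 be arbitrary, and consider Procedure 3.2 with parameters (q_1, q) modified by replacing q_1 with q_1' in the thresholds r q_1/m and R_2 q_1/m only (the follow-up thresholds keep q − q_1). Then the rejection set 𝓡 of the modified procedure satisfies E[|𝓡 ∩ I_{10}| / max(|𝓡|, 1)] ≤ q − q_1. -/

import Mathlib

open MeasureTheory ProbabilityTheory Finset

namespace Replicability

/-- A selection rule `S` is measurable: the preimage of each possible selected set is a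
measurable subset of `[0,1]^m` (here all of `ℝ^m`). -/
def MeasRule (m : ℕ) (S : (Fin m → ℝ) → Finset (Fin m)) : Prop :=
  ∀ A : Finset (Fin m), MeasurableSet {p : Fin m → ℝ | S p = A}

/-- A valid selection rule: for any `p`, any `j ∈ S p`, and any `p'` agreeing with `p` in all
coordinates except possibly the `j`-th such that `j` is still selected under `p'`,
the selected set is unchanged. -/
def ValidRule (m : ℕ) (S : (Fin m → ℝ) → Finset (Fin m)) : Prop :=
  ∀ p p' : Fin m → ℝ, ∀ j ∈ S p, (∀ i, i ≠ j → p' i = p i) → j ∈ S p' → S p' = S p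

/-- Null p-values are superuniform: if `h j = false` (hypothesis `j` is a true null in this
study) then `Pr(P_j ≤ x) ≤ x` for all `x ∈ [0,1]`. -/
def Superuniform {Ω : Type*} [MeasurableSpace Ω] (μ : Measure Ω) {m : ℕ}
    (P : Ω → Fin m → ℝ) (h : Fin m → Bool) : Prop :=
  ∀ j : Fin m, h j = false → ∀ x : ℝ, 0 ≤ x → x ≤ 1 →
    μ {ω | P ω j ≤ x} ≤ ENNReal.ofReal x

/-- p-values take values in `[0,1]`. -/
def InUnit {Ω : Type*} {m : ℕ} (P : Ω → Fin m → ℝ) : Prop :=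
  ∀ ω j, P ω j ∈ Set.Icc (0 : ℝ) 1

/-- The (generalized) rejection set of Procedure 3.2: with selected set `𝓡₁ = S p₁` of size
`R₁`, primary thresholds `r * a / m` and follow-up thresholds `r * b R₁ / R₁`, let
`R₂ = max { r ≤ m : #{j ∈ 𝓡₁ : p₁ⱼ ≤ r a/m ∧ p₂ⱼ ≤ r (b R₁)/R₁} = r }`, and reject
`{j ∈ 𝓡₁ : p₁ⱼ ≤ R₂ a/m ∧ p₂ⱼ ≤ R₂ (b R₁)/R₁}`.  The basic Procedure 3.2 with parameters
`(q₁, q)` is obtained with `a = q₁` and `b = fun _ => q - q₁`. -/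
noncomputable def rejSet (m : ℕ) (S : (Fin m → ℝ) → Finset (Fin m))
    (a : ℝ) (b : ℕ → ℝ) (p1 p2 : Fin m → ℝ) : Finset (Fin m) :=
  let R1 := (S p1).card
  let R2 := sSup {r : ℕ | r ≤ m ∧
    ((S p1).filter
      (fun j => p1 j ≤ r * a / m ∧ p2 j ≤ r * b R1 / R1)).card = r}
  (S p1).filter (fun j => p1 j ≤ R2 * a / m ∧ p2 j ≤ R2 * b R1 / R1)

/-- False discovery proportion of rejection set `R` with respect to the set `I` of true
nulls: `|R ∩ I| / max(|R|, 1)`. -/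
noncomputable def FDP {m : ℕ} (I R : Finset (Fin m)) : ℝ :=
  ((R ∩ I).card : ℝ) / ((max R.card 1 : ℕ) : ℝ)

/-- The set `I_{ab} = {j : (h₁ⱼ, h₂ⱼ) = (a, b)}` (with `true` for 1, `false` for 0). -/
def Iset {m : ℕ} (h1 h2 : Fin m → Bool) (a b : Bool) : Finset (Fin m) :=
  Finset.univ.filter fun j => h1 j = a ∧ h2 j = b

/-- The indices of true no-replicability nulls: `I₀₀ ∪ I₀₁ ∪ I₁₀`. -/
def nullNR {m : ℕ} (h1 h2 : Fin m → Bool) : Finset (Fin m) :=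
  Finset.univ.filter fun j => h1 j = false ∨ h2 j = false

/-- Harmonic sum `∑_{i=1}^n 1/i`. -/
noncomputable def Hsum (n : ℕ) : ℝ := ∑ i ∈ Finset.range n, (1 : ℝ) / (i + 1)

/-- PRDS property of a random vector `Q` on a set `T` of coordinates: for every measurable
increasing set `D` and every `i ∈ T`, some monotone measurable `g` is a version of
`p ↦ Pr(Q ∈ D | Q_i = p)`. -/
def PRDS {Ω : Type*} [MeasurableSpace Ω] (μ : Measure Ω) {m : ℕ}
    (Q : Ω → Fin m → ℝ) (T : Set (Fin m)) : Prop :=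
  ∀ D : Set (Fin m → ℝ), MeasurableSet D →
    (∀ x ∈ D, ∀ y : Fin m → ℝ, x ≤ y → y ∈ D) →
    ∀ i ∈ T, ∃ g : ℝ → ℝ, Monotone g ∧ Measurable g ∧
      ∀ B : Set ℝ, MeasurableSet B →
        (μ ({ω | Q ω ∈ D} ∩ {ω | Q ω i ∈ B})).toReal =
          ∫ ω in {ω | Q ω i ∈ B}, g (Q ω i) ∂μ

end Replicability

namespace Replicability

/-- The largest fixed point of `r ↦ (E r).card` for a monotone family `E` of subsets of `Fin m`. -/
lemma card_eq_sSup_and_le {m : ℕ} {E : ℕ → Finset (Fin m)} (hE : Monotone E) :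
    (E (sSup {r : ℕ | r ≤ m ∧ (E r).card = r})).card = sSup {r : ℕ | r ≤ m ∧ (E r).card = r} ∧
      ∀ r, r ≤ (E r).card → r ≤ sSup {r : ℕ | r ≤ m ∧ (E r).card = r} := by
  have hm : ∀ r, (E r).card ≤ m := fun r => by simpa using Finset.card_le_univ (E r)
  have hbdd : BddAbove {r : ℕ | r ≤ m ∧ (E r).card = r} := ⟨m, fun r hr => hr.1⟩
  have hbdd' : BddAbove {r : ℕ | r ≤ (E r).card} := ⟨m, fun r hr => le_trans hr (hm r)⟩
  have hne' : {r : ℕ | r ≤ (E r).card}.Nonempty := ⟨0, Nat.zero_le _⟩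
  have hmem := Nat.sSup_mem hne' hbdd'
  set s := sSup {r : ℕ | r ≤ (E r).card}
  have hs : s ∈ {r : ℕ | r ≤ m ∧ (E r).card = r} := by
    refine ⟨le_trans hmem (hm s), le_antisymm ?_ hmem⟩
    exact le_csSup hbdd' (Finset.card_le_card (hE hmem))
  exact ⟨(Nat.sSup_mem ⟨s, hs⟩ hbdd).2,
    fun r hr => (le_csSup hbdd' hr).trans (le_csSup hbdd hs)⟩

/-- The set of hypotheses passing both thresholds at level `r`. -/
noncomputable def passSet {m : ℕ} (S : (Fin m → ℝ) → Finset (Fin m)) (a b : ℝ)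
    (p1 p2 : Fin m → ℝ) (r : ℕ) : Finset (Fin m) :=
  (S p1).filter (fun j => p1 j ≤ r * a / m ∧ p2 j ≤ r * b / (S p1).card)

lemma rejSet_eq_passSet {m : ℕ} (S : (Fin m → ℝ) → Finset (Fin m)) (a b : ℝ)
    (p1 p2 : Fin m → ℝ) :
    rejSet m S a (fun _ => b) p1 p2 = passSet S a b p1 p2
      (sSup {r : ℕ | r ≤ m ∧ (passSet S a b p1 p2 r).card = r}) := rfl

lemma passSet_mono {m : ℕ} (S : (Fin m → ℝ) → Finset (Fin m)) {a b : ℝ} (ha : 0 ≤ a)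
    (hb : 0 ≤ b) (p1 p2 : Fin m → ℝ) : Monotone (passSet S a b p1 p2) := by
  intro r s hrs j hj
  have hrs' : (r : ℝ) ≤ s := by exact_mod_cast hrs
  simp only [passSet, mem_filter] at hj ⊢
  exact ⟨hj.1, hj.2.1.trans (by gcongr), hj.2.2.trans (by gcongr)⟩

lemma card_rejSet {m : ℕ} (S : (Fin m → ℝ) → Finset (Fin m)) {a b : ℝ} (ha : 0 ≤ a)
    (hb : 0 ≤ b) (p1 p2 : Fin m → ℝ) :
    (rejSet m S a (fun _ => b) p1 p2).card =
      sSup {r : ℕ | r ≤ m ∧ (passSet S a b p1 p2 r).card = r} :=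
  (card_eq_sSup_and_le (passSet_mono S ha hb p1 p2)).1

lemma rejSet_eq_passSet_card {m : ℕ} (S : (Fin m → ℝ) → Finset (Fin m)) {a b : ℝ} (ha : 0 ≤ a)
    (hb : 0 ≤ b) (p1 p2 : Fin m → ℝ) :
    rejSet m S a (fun _ => b) p1 p2 =
      passSet S a b p1 p2 (rejSet m S a (fun _ => b) p1 p2).card := by
  rw [card_rejSet S ha hb, rejSet_eq_passSet]

lemma card_rejSet_antitone {m : ℕ} (S : (Fin m → ℝ) → Finset (Fin m)) {a b : ℝ} (ha : 0 ≤ a)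
    (hb : 0 ≤ b) (p1 : Fin m → ℝ) :
    Antitone fun p2 => (rejSet m S a (fun _ => b) p1 p2).card := by
  intro x y hxy
  change (rejSet m S a (fun _ => b) p1 y).card ≤ (rejSet m S a (fun _ => b) p1 x).card
  rw [card_rejSet S ha hb p1 x]
  refine (card_eq_sSup_and_le (passSet_mono S ha hb p1 x)).2 _ ?_
  conv_lhs => rw [rejSet_eq_passSet_card S ha hb p1 y]
  refine Finset.card_le_card fun j hj => ?_
  simp only [passSet, mem_filter] at hj ⊢
  exact ⟨hj.1, hj.2.1, (hxy j).trans hj.2.2⟩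

lemma measurable_finset_of_mem {α : Type*} [MeasurableSpace α] {m : ℕ} {f : α → Finset (Fin m)}
    (hf : ∀ j, MeasurableSet {x | j ∈ f x}) : Measurable[_, ⊤] f := by
  let : MeasurableSpace (Finset (Fin m)) := ⊤
  refine measurable_to_countable' fun A => ?_
  have : f ⁻¹' {A} = ⋂ j, {x | j ∈ f x ↔ j ∈ A} := by
    ext x
    simp [Finset.ext_iff]
  rw [this]
  exact MeasurableSet.iInter fun j => (hf j).iff (MeasurableSet.const _)

lemma measurable_rejSet {m : ℕ} {S : (Fin m → ℝ) → Finset (Fin m)} (hS : MeasRule m S)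
    (a b : ℝ) :
    Measurable[_, ⊤] fun p : (Fin m → ℝ) × (Fin m → ℝ) =>
      rejSet m S a (fun _ => b) p.1 p.2 := by
  let : MeasurableSpace (Finset (Fin m)) := ⊤
  have hSm : Measurable S := measurable_to_countable' fun A => hS A
  have hpass : ∀ r, Measurable fun p : (Fin m → ℝ) × (Fin m → ℝ) =>
      passSet S a b p.1 p.2 r := by
    intro r
    refine measurable_finset_of_mem fun j => ?_
    have hS1 : Measurable fun p : (Fin m → ℝ) × (Fin m → ℝ) => S p.1 := hSm.comp measurable_fst
    have hc : Measurable fun p : (Fin m → ℝ) × (Fin m → ℝ) => ((S p.1).card : ℝ) :=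
      (measurable_from_top (f := fun A : Finset (Fin m) => (A.card : ℝ))).comp hS1
    simp only [passSet, mem_filter]
    have h1 : MeasurableSet {p : (Fin m → ℝ) × (Fin m → ℝ) | p.1 j ≤ r * a / m} :=
      measurableSet_le (by fun_prop) (by fun_prop)
    have h2 : MeasurableSet
        {p : (Fin m → ℝ) × (Fin m → ℝ) | p.2 j ≤ r * b / (S p.1).card} :=
      measurableSet_le (by fun_prop) (by fun_prop)
    exact (hS1 (t := {A | j ∈ A}) trivial).inter (h1.inter h2)
  refine measurable_finset_of_mem fun j => ?_
  have : {p : (Fin m → ℝ) × (Fin m → ℝ) | j ∈ rejSet m S a (fun _ => b) p.1 p.2} =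
      (fun p r => passSet S a b p.1 p.2 r) ⁻¹'
        {E : ℕ → Finset (Fin m) | j ∈ E (sSup {r : ℕ | r ≤ m ∧ (E r).card = r})} := rfl
  rw [this]
  refine measurable_pi_lambda _ hpass ?_
  have hsup : Measurable fun E : ℕ → Finset (Fin m) =>
      sSup {r : ℕ | r ≤ m ∧ (E r).card = r} := by
    have heq : (fun E : ℕ → Finset (Fin m) => sSup {r : ℕ | r ≤ m ∧ (E r).card = r}) =
        (fun A : Finset ℕ => sSup (A : Set ℕ)) ∘ fun E : ℕ → Finset (Fin m) =>
          (Finset.range (m + 1)).filter fun r => (E r).card = r := by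
      funext E
      simp
    let : MeasurableSpace (Finset ℕ) := ⊤
    rw [heq]
    refine measurable_from_top.comp (measurable_to_countable' fun A => ?_)
    have : (fun E : ℕ → Finset (Fin m) =>
        (Finset.range (m + 1)).filter fun r => (E r).card = r) ⁻¹' {A} =
        ⋂ r, {E : ℕ → Finset (Fin m) | (r ∈ Finset.range (m + 1) ∧ (E r).card = r) ↔ r ∈ A} := by
      ext E
      simp [Finset.ext_iff]
    rw [this]
    refine MeasurableSet.iInter fun r => MeasurableSet.iff
      (MeasurableSet.inter (MeasurableSet.const _) ?_) (MeasurableSet.const _)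
    exact measurable_pi_apply (X := fun _ : ℕ => Finset (Fin m)) r
      (t := {A : Finset (Fin m) | A.card = r}) trivial
  have hunion : {E : ℕ → Finset (Fin m) | j ∈ E (sSup {r : ℕ | r ≤ m ∧ (E r).card = r})} =
      ⋃ s, ({E | sSup {r : ℕ | r ≤ m ∧ (E r).card = r} = s} ∩ {E | j ∈ E s}) := by
    ext E
    simp
  rw [hunion]
  refine MeasurableSet.iUnion fun s => MeasurableSet.inter (hsup (measurableSet_singleton s)) ?_
  exact measurable_pi_apply (X := fun _ : ℕ => Finset (Fin m)) s
    (t := {A : Finset (Fin m) | j ∈ A}) trivial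

section PRDS

variable {Ω : Type*} [MeasurableSpace Ω] {μ : Measure Ω} [IsProbabilityMeasure μ] {m : ℕ}
  {Q : Ω → Fin m → ℝ}

lemma Superuniform.measureReal_le {h : Fin m → Bool} (hsup : Superuniform μ Q h) {j : Fin m}
    (hj : h j = false) {t : ℝ} (ht : 0 ≤ t) : μ.real {ω | Q ω j ≤ t} ≤ t := by
  rcases le_total t 1 with h1 | h1
  · exact ENNReal.toReal_le_of_le_ofReal ht (hsup j hj t ht h1)
  · exact measureReal_le_one.trans h1

/-- Under PRDS, `Pr(Q ∈ D | Q_j ≤ t)` is nondecreasing in `t` for increasing `D`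
(in cross-multiplied form). -/
lemma PRDS.measureReal_mul_le {T : Set (Fin m)} (hQ : Measurable Q) (hQu : InUnit Q)
    (hPRDS : PRDS μ Q T) {j : Fin m} (hj : j ∈ T) {D : Set (Fin m → ℝ)} (hD : MeasurableSet D)
    (hDup : IsUpperSet D) {s t : ℝ} (hst : s ≤ t) :
    μ.real ({ω | Q ω ∈ D} ∩ {ω | Q ω j ≤ s}) * μ.real {ω | Q ω j ≤ t} ≤
      μ.real ({ω | Q ω ∈ D} ∩ {ω | Q ω j ≤ t}) * μ.real {ω | Q ω j ≤ s} := by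
  obtain ⟨g, hg, hgm, hgD⟩ := hPRDS D hD (fun x hx y hxy => hDup hxy hx) j hj
  have hQj : Measurable fun ω => Q ω j := (measurable_pi_apply j).comp hQ
  have hint : Integrable (fun ω => g (Q ω j)) μ := by
    refine Integrable.of_mem_Icc (g 0) (g 1) (hgm.comp hQj).aemeasurable
      (ae_of_all _ fun ω => ⟨hg (hQu ω j).1, hg (hQu ω j).2⟩)
  have hs := hgD (Set.Iic s) measurableSet_Iic
  have ht := hgD (Set.Iic t) measurableSet_Iic
  simp only [Set.mem_Iic] at hs ht
  have hms : MeasurableSet {ω | Q ω j ≤ s} := hQj measurableSet_Iic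
  have hmst : MeasurableSet {ω | s < Q ω j ∧ Q ω j ≤ t} := hQj measurableSet_Ioc
  have hunion : {ω | Q ω j ≤ t} = {ω | Q ω j ≤ s} ∪ {ω | s < Q ω j ∧ Q ω j ≤ t} := by
    ext ω
    simp only [Set.mem_ofPred_eq, Set.mem_union]
    constructor
    · intro h
      rcases le_or_gt (Q ω j) s with h' | h'
      · exact Or.inl h'
      · exact Or.inr ⟨h', h⟩
    · rintro (h | h)
      exacts [h.trans hst, h.2]
  have hdisj : Disjoint {ω | Q ω j ≤ s} {ω | s < Q ω j ∧ Q ω j ≤ t} :=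
    Set.disjoint_left.2 fun ω h h' => not_lt.2 h h'.1
  have hμ : μ.real {ω | Q ω j ≤ t} =
      μ.real {ω | Q ω j ≤ s} + μ.real {ω | s < Q ω j ∧ Q ω j ≤ t} := by
    rw [hunion, measureReal_union hdisj hmst]
  have hI : ∫ ω in {ω | Q ω j ≤ t}, g (Q ω j) ∂μ = ∫ ω in {ω | Q ω j ≤ s}, g (Q ω j) ∂μ +
      ∫ ω in {ω | s < Q ω j ∧ Q ω j ≤ t}, g (Q ω j) ∂μ := by
    rw [hunion, setIntegral_union hdisj hmst hint.integrableOn hint.integrableOn]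
  have hle : ∫ ω in {ω | Q ω j ≤ s}, g (Q ω j) ∂μ ≤ g s * μ.real {ω | Q ω j ≤ s} := by
    calc _ ≤ ∫ _ in {ω | Q ω j ≤ s}, g s ∂μ :=
          setIntegral_mono_on hint.integrableOn (integrable_const _).integrableOn hms
            fun ω hω => hg hω
      _ = _ := by rw [setIntegral_const, smul_eq_mul, mul_comm]
  have hge : g s * μ.real {ω | s < Q ω j ∧ Q ω j ≤ t} ≤
      ∫ ω in {ω | s < Q ω j ∧ Q ω j ≤ t}, g (Q ω j) ∂μ := by
    calc _ = ∫ _ in {ω | s < Q ω j ∧ Q ω j ≤ t}, g s ∂μ := by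
          rw [setIntegral_const, smul_eq_mul, mul_comm]
      _ ≤ _ := setIntegral_mono_on (integrable_const _).integrableOn hint.integrableOn hmst
            fun ω hω => hg (le_of_lt hω.1)
  change μ.real ({ω | Q ω ∈ D} ∩ {ω | Q ω j ≤ s}) = _ at hs
  change μ.real ({ω | Q ω ∈ D} ∩ {ω | Q ω j ≤ t}) = _ at ht
  rw [hs, ht, hI, hμ]
  have h0 : 0 ≤ μ.real {ω | Q ω j ≤ s} := measureReal_nonneg
  have h0' : 0 ≤ μ.real {ω | s < Q ω j ∧ Q ω j ≤ t} := measureReal_nonneg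
  nlinarith [mul_le_mul_of_nonneg_right hle h0', mul_le_mul_of_nonneg_right hge h0]

/-- For a superuniform coordinate `Q_j` of a PRDS vector and an antitone step function `f`,
`E[1{Q_j ≤ c f(Q)} / f(Q)] ≤ c`. -/
lemma integral_inv_card_le {h : Fin m → Bool} (hQ : Measurable Q) (hQu : InUnit Q)
    (hsup : Superuniform μ Q h) (hPRDS : PRDS μ Q {j | h j = false}) {j : Fin m}
    (hj : h j = false) {f : (Fin m → ℝ) → ℕ} (hf : Measurable f) (hanti : Antitone f) {n : ℕ}
    (hn : ∀ x, f x ≤ n) {c : ℝ} (hc : 0 ≤ c) :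
    ∫ ω, (if Q ω j ≤ c * f (Q ω) then (f (Q ω) : ℝ)⁻¹ else 0) ∂μ ≤ c := by
  have hQj : Measurable fun ω => Q ω j := (measurable_pi_apply j).comp hQ
  let D : ℕ → Set (Fin m → ℝ) := fun k => {x | f x ≤ k}
  have hDm : ∀ k, MeasurableSet (D k) := fun k => hf measurableSet_Iic
  have hDup : ∀ k, IsUpperSet (D k) := fun k x y hxy hx => (hanti hxy).trans hx
  let F : ℕ → ℝ := fun k => μ.real {ω | Q ω j ≤ c * k}
  let A : ℕ → ℕ → ℝ := fun k l => μ.real ({ω | Q ω ∈ D k} ∩ {ω | Q ω j ≤ c * l})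
  have hmeas : ∀ k l : ℕ, MeasurableSet ({ω | Q ω ∈ D k} ∩ {ω | Q ω j ≤ c * l}) :=
    fun k l => (hQ (hDm k)).inter (hQj measurableSet_Iic)
  have hpt : ∀ ω, (if Q ω j ≤ c * f (Q ω) then (f (Q ω) : ℝ)⁻¹ else 0) =
      ∑ k ∈ Finset.range n, ((k + 1 : ℕ) : ℝ)⁻¹ *
        (({ω | Q ω ∈ D (k + 1)} ∩ {ω | Q ω j ≤ c * (k + 1 : ℕ)}).indicator (fun _ => (1 : ℝ)) ω -
          ({ω | Q ω ∈ D k} ∩ {ω | Q ω j ≤ c * (k + 1 : ℕ)}).indicator (fun _ => (1 : ℝ)) ω) := by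
    intro ω
    have hterm : ∀ k : ℕ, ((k + 1 : ℕ) : ℝ)⁻¹ *
        (({ω | Q ω ∈ D (k + 1)} ∩ {ω | Q ω j ≤ c * (k + 1 : ℕ)}).indicator (fun _ => (1 : ℝ)) ω -
          ({ω | Q ω ∈ D k} ∩ {ω | Q ω j ≤ c * (k + 1 : ℕ)}).indicator (fun _ => (1 : ℝ)) ω) =
        if f (Q ω) = k + 1 then
          (if Q ω j ≤ c * f (Q ω) then (f (Q ω) : ℝ)⁻¹ else 0) else 0 := by
      intro k
      simp only [Set.indicator_apply, Set.mem_inter_iff, Set.mem_ofPred_eq, D]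
      rcases lt_trichotomy (f (Q ω)) (k + 1) with h | h | h
      · simp [h.ne, h.le, Nat.lt_succ_iff.1 h]
      · simp [h]
      · have h1 : ¬ f (Q ω) ≤ k + 1 := by omega
        have h2 : ¬ f (Q ω) ≤ k := by omega
        simp [h.ne', h1, h2]
    simp_rw [hterm]
    rcases Nat.eq_zero_or_pos (f (Q ω)) with h | h
    · simp [h]
    · rw [Finset.sum_eq_single (f (Q ω) - 1)]
      · rw [if_pos (by omega : f (Q ω) = f (Q ω) - 1 + 1)]
      · intro k _ hk
        rw [if_neg (by omega)]
      · intro hk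
        have := hn (Q ω)
        exact absurd (Finset.mem_range.2 (by omega)) hk
  have hind : ∀ k l : ℕ, Integrable
      (({ω | Q ω ∈ D k} ∩ {ω | Q ω j ≤ c * l}).indicator (fun _ => (1 : ℝ))) μ :=
    fun k l => (integrable_const _).indicator (hmeas k l)
  have hval : ∀ k l : ℕ,
      ∫ ω, ({ω | Q ω ∈ D k} ∩ {ω | Q ω j ≤ c * l}).indicator (fun _ => (1 : ℝ)) ω ∂μ = A k l :=
    fun k l => integral_indicator_one (hmeas k l)
  simp_rw [hpt]
  rw [integral_finsetSum _ fun k _ => Integrable.const_mul (f := fun ω => _ - _)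
    ((hind _ _).sub (hind _ _)) _]
  simp_rw [integral_const_mul, integral_sub (hind _ _) (hind _ _), hval]
  have hA_le : ∀ k l, A k l ≤ F l := fun k l => measureReal_mono Set.inter_subset_right
  have hstep : ∀ k : ℕ, ((k + 1 : ℕ) : ℝ)⁻¹ * (A (k + 1) (k + 1) - A k (k + 1)) ≤
      c * (A (k + 1) (k + 1) / F (k + 1)) - c * (A k k / F k) := by
    intro k
    have hA0 : 0 ≤ A k (k + 1) := measureReal_nonneg
    have hAmono : A k (k + 1) ≤ A (k + 1) (k + 1) :=
      measureReal_mono (Set.inter_subset_inter_left _ fun ω hω => Nat.le_succ_of_le hω)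
    have hF0 : 0 ≤ F (k + 1) := measureReal_nonneg
    have hFk0 : 0 ≤ F k := measureReal_nonneg
    have hFmono : F k ≤ F (k + 1) := measureReal_mono fun ω hω =>
      le_trans hω (mul_le_mul_of_nonneg_left (by simp) hc)
    have hFle : F (k + 1) ≤ c * (k + 1 : ℕ) := hsup.measureReal_le hj (by positivity)
    have hcross : A k k * F (k + 1) ≤ A k (k + 1) * F k :=
      hPRDS.measureReal_mul_le hQ hQu hj (hDm k) (hDup k)
        (mul_le_mul_of_nonneg_left (by simp) hc)
    rcases hF0.eq_or_lt with hz | hpos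
    · have hFk : F k = 0 := le_antisymm (hz ▸ hFmono) hFk0
      have h1 : A (k + 1) (k + 1) = 0 :=
        le_antisymm (hz ▸ hA_le _ _) (hA0.trans hAmono)
      have h2 : A k (k + 1) = 0 := le_antisymm (h1 ▸ hAmono) hA0
      simp [← hz, hFk, h1, h2]
    · have hdiv : A k k / F k ≤ A k (k + 1) / F (k + 1) := by
        rcases hFk0.eq_or_lt with hz' | hpos'
        · rw [← hz', div_zero]
          positivity
        · rwa [div_le_div_iff₀ hpos' hpos]
      have hinv : ((k + 1 : ℕ) : ℝ)⁻¹ ≤ c / F (k + 1) := by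
        rw [inv_eq_one_div, div_le_div_iff₀ (by positivity) hpos, one_mul]
        exact hFle
      calc ((k + 1 : ℕ) : ℝ)⁻¹ * (A (k + 1) (k + 1) - A k (k + 1))
          ≤ c / F (k + 1) * (A (k + 1) (k + 1) - A k (k + 1)) :=
            mul_le_mul_of_nonneg_right hinv (sub_nonneg.2 hAmono)
        _ = c * (A (k + 1) (k + 1) / F (k + 1)) - c * (A k (k + 1) / F (k + 1)) := by ring
        _ ≤ _ := sub_le_sub_left (mul_le_mul_of_nonneg_left hdiv hc) _
  calc _ ≤ ∑ k ∈ Finset.range n,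
        (c * (A (k + 1) (k + 1) / F (k + 1)) - c * (A k k / F k)) :=
        Finset.sum_le_sum fun k _ => hstep k
    _ = c * (A n n / F n) - c * (A 0 0 / F 0) :=
        Finset.sum_range_sub (fun k => c * (A k k / F k)) n
    _ ≤ c * (A n n / F n) :=
        sub_le_self _ (mul_nonneg hc (div_nonneg measureReal_nonneg measureReal_nonneg))
    _ ≤ c := mul_le_of_le_one_right hc (div_le_one_of_le₀ (hA_le n n) measureReal_nonneg)

end PRDS

lemma FDP_nonneg {m : ℕ} (I R : Finset (Fin m)) : 0 ≤ FDP I R := by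
  unfold FDP
  positivity

lemma FDP_le_one {m : ℕ} (I R : Finset (Fin m)) : FDP I R ≤ 1 := by
  refine div_le_one_of_le₀ ?_ (by positivity)
  exact_mod_cast (Finset.card_le_card Finset.inter_subset_left).trans (le_max_left _ _)

lemma FDP_rejSet_le {m : ℕ} (S : (Fin m → ℝ) → Finset (Fin m)) {a b : ℝ} (ha : 0 ≤ a)
    (hb : 0 ≤ b) (p1 p2 : Fin m → ℝ) (I : Finset (Fin m)) :
    FDP I (rejSet m S a (fun _ => b) p1 p2) ≤ ∑ j ∈ S p1 ∩ I,
      if p2 j ≤ b / (S p1).card * (rejSet m S a (fun _ => b) p1 p2).card then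
        ((rejSet m S a (fun _ => b) p1 p2).card : ℝ)⁻¹ else 0 := by
  have hR : ∀ j ∈ rejSet m S a (fun _ => b) p1 p2,
      j ∈ passSet S a b p1 p2 (rejSet m S a (fun _ => b) p1 p2).card :=
    fun j hj => rejSet_eq_passSet_card S ha hb p1 p2 ▸ hj
  set R := rejSet m S a (fun _ => b) p1 p2
  rcases Nat.eq_zero_or_pos R.card with h | h
  · simp [FDP, Finset.card_eq_zero.1 h]
  · rw [FDP, max_eq_left h, ← Finset.sum_filter, Finset.sum_const, nsmul_eq_mul, div_eq_mul_inv]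
    gcongr
    intro j hj
    rw [mem_inter] at hj
    have hj' := hR j hj.1
    rw [passSet, mem_filter] at hj'
    rw [mem_filter, mem_inter]
    exact ⟨⟨hj'.1, hj.2⟩, hj'.2.2.trans (le_of_eq (by ring))⟩

/-- The bound on the expected false discovery proportion for fixed primary-study p-values. -/
lemma integral_FDP_rejSet_le {Ω : Type*} [MeasurableSpace Ω] {μ : Measure Ω}
    [IsProbabilityMeasure μ] {m : ℕ} {P2 : Ω → Fin m → ℝ} (hP2 : Measurable P2)
    (hP2u : InUnit P2) {h2 : Fin m → Bool} (hsup2 : Superuniform μ P2 h2)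
    (hPRDS : PRDS μ P2 {j | h2 j = false}) {S : (Fin m → ℝ) → Finset (Fin m)}
    (hS : MeasRule m S) {a b : ℝ} (ha : 0 ≤ a) (hb : 0 ≤ b) {I : Finset (Fin m)}
    (hI : ∀ j ∈ I, h2 j = false) (p1 : Fin m → ℝ) :
    ∫ ω, FDP I (rejSet m S a (fun _ => b) p1 (P2 ω)) ∂μ ≤ b := by
  let : MeasurableSpace (Finset (Fin m)) := ⊤
  have hrej : Measurable fun p2 => rejSet m S a (fun _ => b) p1 p2 :=
    (measurable_rejSet hS a b).comp measurable_prodMk_left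
  have hf : Measurable fun p2 => (rejSet m S a (fun _ => b) p1 p2).card :=
    (measurable_from_top (f := Finset.card)).comp hrej
  have hcard : ∀ p2, (rejSet m S a (fun _ => b) p1 p2).card ≤ m := fun p2 => by
    simpa using Finset.card_le_univ (rejSet m S a (fun _ => b) p1 p2)
  have hfc : Measurable fun ω => ((rejSet m S a (fun _ => b) p1 (P2 ω)).card : ℝ) :=
    measurable_from_top.comp (hf.comp hP2)
  have hint : ∀ j, Integrable (fun ω =>
      if P2 ω j ≤ b / (S p1).card * (rejSet m S a (fun _ => b) p1 (P2 ω)).card then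
        ((rejSet m S a (fun _ => b) p1 (P2 ω)).card : ℝ)⁻¹ else 0) μ := by
    intro j
    refine Integrable.of_mem_Icc 0 1 (Measurable.aemeasurable ?_) (ae_of_all _ fun ω => ?_)
    · exact Measurable.ite (measurableSet_le (by fun_prop) (by fun_prop)) hfc.inv measurable_const
    · split_ifs
      · exact ⟨by positivity, Nat.cast_inv_le_one _⟩
      · exact ⟨le_rfl, zero_le_one⟩
  have hFDP : Integrable (fun ω => FDP I (rejSet m S a (fun _ => b) p1 (P2 ω))) μ :=
    Integrable.of_mem_Icc 0 1
      ((measurable_from_top (f := FDP I)).comp (hrej.comp hP2)).aemeasurable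
      (ae_of_all _ fun ω => ⟨FDP_nonneg _ _, FDP_le_one _ _⟩)
  calc ∫ ω, FDP I (rejSet m S a (fun _ => b) p1 (P2 ω)) ∂μ
      ≤ ∫ ω, ∑ j ∈ S p1 ∩ I,
        (if P2 ω j ≤ b / (S p1).card * (rejSet m S a (fun _ => b) p1 (P2 ω)).card then
          ((rejSet m S a (fun _ => b) p1 (P2 ω)).card : ℝ)⁻¹ else 0) ∂μ :=
        integral_mono hFDP (integrable_finsetSum _ fun j _ => hint j)
          fun ω => FDP_rejSet_le S ha hb p1 (P2 ω) I
    _ = ∑ j ∈ S p1 ∩ I, ∫ ω,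
        (if P2 ω j ≤ b / (S p1).card * (rejSet m S a (fun _ => b) p1 (P2 ω)).card then
          ((rejSet m S a (fun _ => b) p1 (P2 ω)).card : ℝ)⁻¹ else 0) ∂μ :=
        integral_finsetSum _ fun j _ => hint j
    _ ≤ ∑ j ∈ S p1 ∩ I, b / (S p1).card :=
        Finset.sum_le_sum fun j hj => integral_inv_card_le hP2 hP2u hsup2 hPRDS
          (hI j (mem_inter.1 hj).2) hf (card_rejSet_antitone S ha hb p1) hcard (by positivity)
    _ ≤ ∑ j ∈ S p1, b / (S p1).card :=
        Finset.sum_le_sum_of_subset_of_nonneg inter_subset_left fun _ _ _ => by positivity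
    _ = (S p1).card * b / (S p1).card := by
        rw [Finset.sum_const, nsmul_eq_mul, mul_div_assoc]
    _ ≤ b := div_le_of_le_mul₀ (by positivity) hb (mul_comm _ _).le

/-- Lemma S2.1, item 3: as in item 2, but with `q₁` replaced by an arbitrary
`q₁' > 0` in the primary-study thresholds only (follow-up thresholds keep `q - q₁`); still
`E[|𝓡 ∩ I₁₀| / max(|𝓡|,1)] ≤ q - q₁`. -/
theorem lemma_S21_item3 {Ω : Type*} [MeasurableSpace Ω]
    (μ : Measure Ω) [IsProbabilityMeasure μ]
    (m : ℕ) (hm : 1 ≤ m)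
    (P1 P2 : Ω → Fin m → ℝ) (hP1 : Measurable P1) (hP2 : Measurable P2)
    (hP1u : InUnit P1) (hP2u : InUnit P2)
    (h1 h2 : Fin m → Bool)
    (hsup1 : Superuniform μ P1 h1) (hsup2 : Superuniform μ P2 h2)
    (hIndep : IndepFun P1 P2 μ)
    (hPRDS : PRDS μ P2 {j | h2 j = false})
    (S : (Fin m → ℝ) → Finset (Fin m)) (hS : MeasRule m S) (hval : ValidRule m S)
    (q1 q : ℝ) (hq1 : 0 < q1) (hq1q : q1 < q) (hq : q < 1)
    (q1' : ℝ) (hq1' : 0 < q1') :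
    ∫ ω, FDP (Iset h1 h2 true false)
        (rejSet m S q1' (fun _ => q - q1) (P1 ω) (P2 ω)) ∂μ ≤ q - q1 := by
  let : MeasurableSpace (Finset (Fin m)) := ⊤
  let G : (Fin m → ℝ) × (Fin m → ℝ) → ℝ := fun p =>
    FDP (Iset h1 h2 true false) (rejSet m S q1' (fun _ => q - q1) p.1 p.2)
  have hG : Measurable G := (measurable_from_top (f := FDP (Iset h1 h2 true false))).comp
    (measurable_rejSet hS q1' (q - q1))
  have := Measure.isProbabilityMeasure_map (μ := μ) hP1.aemeasurable
  have := Measure.isProbabilityMeasure_map (μ := μ) hP2.aemeasurable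
  have hGi : Integrable G ((μ.map P1).prod (μ.map P2)) :=
    Integrable.of_mem_Icc 0 1 hG.aemeasurable
      (ae_of_all _ fun p => ⟨FDP_nonneg _ _, FDP_le_one _ _⟩)
  have hinner : ∀ p1, ∫ p2, G (p1, p2) ∂(μ.map P2) ≤ q - q1 := by
    intro p1
    rw [integral_map hP2.aemeasurable (f := fun p2 => G (p1, p2))
      (hG.comp measurable_prodMk_left).aestronglyMeasurable]
    refine integral_FDP_rejSet_le hP2 hP2u hsup2 hPRDS hS hq1'.le (sub_nonneg.2 hq1q.le) ?_ p1
    intro j hj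
    exact (mem_filter.1 hj).2.2
  calc ∫ ω, G (P1 ω, P2 ω) ∂μ = ∫ p, G p ∂(μ.map fun ω => (P1 ω, P2 ω)) :=
        (integral_map (hP1.prodMk hP2).aemeasurable hG.aestronglyMeasurable).symm
    _ = ∫ p, G p ∂((μ.map P1).prod (μ.map P2)) := by
        rw [(indepFun_iff_map_prod_eq_prod_map_map hP1.aemeasurable hP2.aemeasurable).1 hIndep]
    _ = ∫ p1, ∫ p2, G (p1, p2) ∂(μ.map P2) ∂(μ.map P1) := integral_prod G hGi
    _ ≤ ∫ _, (q - q1) ∂(μ.map P1) :=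
        integral_mono hGi.integral_prod_left (integrable_const _) hinner
    _ = q - q1 := by simp

end Replicability
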